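/- First-order change-of-variables expansion for the deformed domain: Let Ω ⊆ ℝ^d be a bounded open set, let F : ℝ^d → ℝ^d be a C¹ map whose derivative DF is bounded on ℝ^d, and let h : ℝ^d → ℝ be a bounded continuous function. For τ ≥ 0 define Φ_τ : ℝ^d → ℝ^d by Φ_τ(x) = x + τ·F(x). Then there exist constants C > 0 and τ₀ > 0 such that for every τ with 0 < τ < τ₀, the map Φ_τ is injective and | ∫_{Φ_τ(Ω)} h(x) dx − ∫_Ω h(Φ_τ(x)) · (1 + τ·div F(x)) dx | ≤ C·τ². -/

import Mathlib

open Matrix MeasureTheory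

/-- The Jacobian matrix of a map `F : ℝ^d → ℝ^d` at `x`: entry `(i, j)` is the partial
derivative of the `i`-th component of `F` in the `j`-th coordinate direction. -/
noncomputable def jacobianMatrix {d : ℕ} (F : (Fin d → ℝ) → (Fin d → ℝ))
    (x : Fin d → ℝ) : Matrix (Fin d) (Fin d) ℝ :=
  Matrix.of fun i j => fderiv ℝ F x (Pi.single j 1) i

/-- The remainder in the first-order expansion of `det (1 + τ • A)` is quadratic in `τ`, uniformly
over matrices `A` with entries bounded by `M`. -/
lemma Matrix.exists_abs_det_one_add_smul_sub_le {n : Type*} [Fintype n] [DecidableEq n] (M : ℝ) :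
    ∃ K : ℝ, 0 ≤ K ∧ ∀ A : Matrix n n ℝ, (∀ i j, |A i j| ≤ M) → ∀ τ : ℝ, |τ| ≤ 1 →
      |(1 + τ • A).det - (1 + τ * A.trace)| ≤ K * τ ^ 2 := by
  let S : Set (Matrix n n ℝ) := Set.univ.pi fun _ => Set.univ.pi fun _ => Set.Icc (-M) M
  have hS : IsCompact S :=
    isCompact_univ_pi fun _ => isCompact_univ_pi fun _ => isCompact_Icc
  let p : Matrix n n ℝ → Polynomial ℝ := fun A =>
    (1 + (Polynomial.X : Polynomial ℝ) • A.map Polynomial.C).det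
  have hcoeff (k : ℕ) : Continuous fun A => (p A).coeff k := by
    simp only [p, coeff_det_one_add_X_smul_eq_sum_minors]
    fun_prop
  have hdeg (A : Matrix n n ℝ) : (p A).natDegree ≤ Fintype.card n := by
    have := Polynomial.natDegree_det_X_add_C_le A 1
    simpa [p, add_comm] using this
  choose c hc using fun k => hS.exists_bound_of_continuousOn (hcoeff k).continuousOn
  refine ⟨∑ k ∈ Finset.range (Fintype.card n + 1), |c (k + 2)|, by positivity, ?_⟩
  intro A hA τ hτ
  have hAS : A ∈ S := fun i _ j _ => abs_le.mp (hA i j)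
  have hrem : (1 + τ • A).det - (1 + τ * A.trace) = (p A).divX.divX.eval τ * τ ^ 2 := by
    rw [det_one_add_smul]
    ring
  have hdeg' : (p A).divX.divX.natDegree < Fintype.card n + 1 := by
    have := hdeg A
    simp only [Polynomial.natDegree_divX_eq_natDegree_tsub_one]
    lia
  rw [hrem, abs_mul, abs_of_nonneg (sq_nonneg τ), Polynomial.eval_eq_sum_range' hdeg']
  gcongr
  refine (Finset.abs_sum_le_sum_abs _ _).trans (Finset.sum_le_sum fun k _ => ?_)
  rw [Polynomial.coeff_divX, Polynomial.coeff_divX, abs_mul, abs_pow]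
  calc |(p A).coeff (k + 1 + 1)| * |τ| ^ k ≤ |c (k + 2)| * 1 := by
        exact mul_le_mul ((hc (k + 2) A hAS).trans (le_abs_self _))
          (pow_le_one₀ (abs_nonneg τ) hτ) (by positivity) (abs_nonneg _)
    _ = |c (k + 2)| := mul_one _

lemma jacobianMatrix_eq_toMatrix' {d : ℕ} (F : (Fin d → ℝ) → (Fin d → ℝ)) (x : Fin d → ℝ) :
    jacobianMatrix F x = LinearMap.toMatrix' (fderiv ℝ F x : (Fin d → ℝ) →ₗ[ℝ] (Fin d → ℝ)) := by
  ext i j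
  simp [jacobianMatrix, LinearMap.toMatrix'_apply]

lemma det_id_add_smul_fderiv {d : ℕ} (F : (Fin d → ℝ) → (Fin d → ℝ)) (x : Fin d → ℝ) (τ : ℝ) :
    (ContinuousLinearMap.id ℝ (Fin d → ℝ) + τ • fderiv ℝ F x).det =
      (1 + τ • jacobianMatrix F x).det := by
  rw [jacobianMatrix_eq_toMatrix', ContinuousLinearMap.det, ← LinearMap.det_toMatrix']
  simp [LinearMap.toMatrix'_id]

lemma abs_jacobianMatrix_le {d : ℕ} (F : (Fin d → ℝ) → (Fin d → ℝ)) (x : Fin d → ℝ)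
    (i j : Fin d) : |jacobianMatrix F x i j| ≤ ‖fderiv ℝ F x‖ := by
  refine (norm_le_pi_norm (fderiv ℝ F x (Pi.single j 1)) i).trans ?_
  simpa [Pi.norm_single] using (fderiv ℝ F x).le_opNorm (Pi.single j 1)

lemma continuous_jacobianMatrix {d : ℕ} {F : (Fin d → ℝ) → (Fin d → ℝ)} (hF : ContDiff ℝ 1 F) :
    Continuous (jacobianMatrix F) := by
  have := hF.continuous_fderiv one_ne_zero
  refine continuous_matrix fun i j => ?_
  simp only [jacobianMatrix, of_apply]
  fun_prop

/-- A perturbation `x + τ • F x` of the identity is injective when `F` is `M`-Lipschitz and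
`|τ| * M < 1`. -/
lemma LipschitzWith.injective_id_add_smul {E : Type*} [NormedAddCommGroup E] [NormedSpace ℝ E]
    {F : E → E} {M : NNReal} (hF : LipschitzWith M F) {τ : ℝ} (hτ : |τ| * M < 1) :
    Function.Injective fun x => x + τ • F x := by
  intro x y hxy
  have hsub : x - y = τ • (F y - F x) := by
    rw [smul_sub, sub_eq_sub_iff_add_eq_add]
    simpa [add_comm] using hxy
  have hle : ‖x - y‖ ≤ |τ| * M * ‖x - y‖ := by
    calc ‖x - y‖ = |τ| * ‖F y - F x‖ := by rw [hsub, norm_smul, Real.norm_eq_abs]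
      _ ≤ |τ| * (M * ‖y - x‖) := by gcongr; exact hF.norm_sub_le y x
      _ = |τ| * M * ‖x - y‖ := by rw [norm_sub_rev y x, mul_assoc]
  have : ‖x - y‖ = 0 := by nlinarith [norm_nonneg (x - y)]
  exact sub_eq_zero.mp (norm_eq_zero.mp this)

/-- **First-order change-of-variables expansion for the deformed domain.** For `Φ_τ = Id + τ F`
with `F` a `C¹` map with bounded derivative, for all small `τ > 0` the map `Φ_τ` is injective and
`∫_{Φ_τ(Ω)} h = ∫_Ω (h ∘ Φ_τ) · (1 + τ div F) + O(τ²)`. -/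
theorem change_of_variables_first_order (d : ℕ)
    (Ω : Set (Fin d → ℝ)) (hΩopen : IsOpen Ω) (hΩbdd : Bornology.IsBounded Ω)
    (F : (Fin d → ℝ) → (Fin d → ℝ)) (hF : ContDiff ℝ 1 F)
    (hDF : ∃ M : ℝ, ∀ x, ‖fderiv ℝ F x‖ ≤ M)
    (h : (Fin d → ℝ) → ℝ) (hcont : Continuous h) (hbdd : ∃ M : ℝ, ∀ x, |h x| ≤ M) :
    ∃ C > (0 : ℝ), ∃ τ₀ > (0 : ℝ), ∀ τ : ℝ, 0 < τ → τ < τ₀ →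
      Function.Injective (fun x => x + τ • F x) ∧
      |(∫ x in (fun x => x + τ • F x) '' Ω, h x)
        - ∫ x in Ω, h (x + τ • F x) * (1 + τ * (jacobianMatrix F x).trace)|
        ≤ C * τ ^ 2 := by
  obtain ⟨M, hM⟩ := hDF
  obtain ⟨B, hB⟩ := hbdd
  have hM0 : 0 ≤ M := (norm_nonneg _).trans (hM 0)
  have hB0 : 0 ≤ B := (abs_nonneg _).trans (hB 0)
  obtain ⟨K, hK0, hK⟩ := Matrix.exists_abs_det_one_add_smul_sub_le (n := Fin d) M
  have hLip : LipschitzWith ⟨M, hM0⟩ F :=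
    lipschitzWith_of_nnnorm_fderiv_le (hF.differentiable one_ne_zero) hM
  have hJ (x : Fin d → ℝ) (i j : Fin d) : |jacobianMatrix F x i j| ≤ M :=
    (abs_jacobianMatrix_le F x i j).trans (hM x)
  have htrace (x : Fin d → ℝ) : |(jacobianMatrix F x).trace| ≤ d * M := by
    refine (Finset.abs_sum_le_sum_abs _ _).trans ?_
    simpa using Finset.sum_le_sum fun i (_ : i ∈ Finset.univ) => hJ x i i
  have hJcont := continuous_jacobianMatrix hF
  have hFcont := hF.continuous
  have hΩfin : volume Ω < ⊤ := hΩbdd.measure_lt_top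
  have hint {g : (Fin d → ℝ) → ℝ} (hg : Continuous g) : IntegrableOn g Ω :=
    (hg.continuousOn.integrableOn_compact hΩbdd.isCompact_closure).mono_set subset_closure
  refine ⟨K * B * volume.real Ω + 1, by positivity, 1 / (1 + M + d * M), by positivity, ?_⟩
  intro τ hτ0 hτ
  rw [lt_div_iff₀ (by positivity)] at hτ
  have hdM : 0 ≤ τ * (d * M) := by positivity
  have hτM : 0 ≤ τ * M := by positivity
  have hinj : Function.Injective fun x => x + τ • F x :=
    hLip.injective_id_add_smul (by
      rw [abs_of_pos hτ0]
      change τ * M < 1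
      linarith)
  refine ⟨hinj, ?_⟩
  have hderiv (x : Fin d → ℝ) : HasFDerivAt (fun x => x + τ • F x)
      (ContinuousLinearMap.id ℝ (Fin d → ℝ) + τ • fderiv ℝ F x) x :=
    (hasFDerivAt_id x).add
      (((hF.differentiable one_ne_zero) x).hasFDerivAt.const_smul τ)
  have hdet (x : Fin d → ℝ) :
      |(|(1 + τ • jacobianMatrix F x).det| - (1 + τ * (jacobianMatrix F x).trace))|
        ≤ K * τ ^ 2 := by
    have hpos : 0 ≤ 1 + τ * (jacobianMatrix F x).trace := by
      have := mul_le_mul_of_nonneg_left (abs_le.mp (htrace x)).1 hτ0.le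
      linarith
    calc _ = |(|(1 + τ • jacobianMatrix F x).det| - |1 + τ * (jacobianMatrix F x).trace|)| := by
          rw [abs_of_nonneg hpos]
      _ ≤ _ := abs_abs_sub_abs_le _ _
      _ ≤ K * τ ^ 2 := hK _ (hJ x) τ (by rw [abs_of_pos hτ0]; linarith)
  rw [integral_image_eq_integral_abs_det_fderiv_smul volume hΩopen.measurableSet
    (fun x _ => (hderiv x).hasFDerivWithinAt) hinj.injOn]
  simp only [det_id_add_smul_fderiv, smul_eq_mul]
  rw [← integral_sub (hint (by fun_prop)) (hint (by fun_prop))]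
  have hbound := norm_setIntegral_le_of_norm_le_const (μ := volume) (C := K * τ ^ 2 * B) hΩfin
    (f := fun x => |(1 + τ • jacobianMatrix F x).det| * h (x + τ • F x)
      - h (x + τ • F x) * (1 + τ * (jacobianMatrix F x).trace)) fun x _ => by
    rw [mul_comm (h _), ← sub_mul, norm_mul]
    exact mul_le_mul (hdet x) (hB _) (norm_nonneg _) (by positivity)
  rw [Real.norm_eq_abs] at hbound
  nlinarith [sq_nonneg τ]
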